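/- Let B be a block of k⟦G⟧ with cyclic defect group D. Then there exists an open normal subgroup N₀ of G acting trivially on every simple B-module and such that, for every open normal subgroup N of G contained in N₀, the coinvariant algebra B_N is a single block of k[G/N]. -/

import Mathlib

open scoped Classical
set_option maxHeartbeats 1000000
set_option synthInstance.maxHeartbeats 400000

noncomputable section

namespace ProfiniteBlocks

variable (k : Type) [Field k] (G : Type) [Group G] [TopologicalSpace G]

/-- Discrete topology on each finite level group algebra. -/
instance (X : Type) : TopologicalSpace (MonoidAlgebra k X) := ⊥

/-- The canonical quotient homomorphism `G/N → G/M` for `N ≤ M`. -/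
def qHom (N M : OpenNormalSubgroup G) (h : N ≤ M) :
    G ⧸ N.toSubgroup →* G ⧸ M.toSubgroup :=
  QuotientGroup.map _ _ (MonoidHom.id G) (fun x hx => h hx)

/-- The induced algebra homomorphism `k[G/N] → k[G/M]` for `N ≤ M`. -/
def tHom (N M : OpenNormalSubgroup G) (h : N ≤ M) :
    MonoidAlgebra k (G ⧸ N.toSubgroup) →ₐ[k] MonoidAlgebra k (G ⧸ M.toSubgroup) :=
  MonoidAlgebra.mapDomainAlgHom k k (qHom G N M h)

/-- The completed group algebra `k⟦G⟧`, realized as the inverse limit of the finite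
level group algebras `k[G/N]` over all open normal subgroups `N` of `G`, sitting inside
their product. -/
def CGA : Subalgebra k (∀ N : OpenNormalSubgroup G, MonoidAlgebra k (G ⧸ N.toSubgroup)) where
  carrier := {x | ∀ (N M : OpenNormalSubgroup G) (h : N ≤ M), tHom k G N M h (x N) = x M}
  add_mem' hx hy N M h := by simp [map_add, hx N M h, hy N M h]
  mul_mem' hx hy N M h := by simp [map_mul, hx N M h, hy N M h]
  algebraMap_mem' r N M h := by
    simp [tHom, MonoidAlgebra.mapDomainAlgHom, MonoidAlgebra.mapDomainRingHom,
      Finsupp.mapDomain_single]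

instance : Ring (CGA k G) := inferInstance
instance : Algebra k (CGA k G) := inferInstance

/-- `k⟦G⟧` carries the inverse limit topology (each `k[G/N]` being discrete). -/
instance : TopologicalSpace (CGA k G) := inferInstanceAs (TopologicalSpace (Subtype _))

/-- The canonical (continuous) inclusion of `G` into `k⟦G⟧`. -/
def ofG : G →* CGA k G where
  toFun g := ⟨fun N => MonoidAlgebra.single ((g : G) : G ⧸ N.toSubgroup) 1, by
    intro N M h
    simp [tHom, MonoidAlgebra.mapDomainAlgHom, MonoidAlgebra.mapDomainRingHom,
      Finsupp.mapDomain_single, qHom, QuotientGroup.map_mk]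
    rfl⟩
  map_one' := by
    ext N
    simp [MonoidAlgebra.one_def]
  map_mul' g g' := by
    ext N
    simp [MonoidAlgebra.single_mul_single]


/-- The map between quotient modules induced by `f` (the canonical map whenever
`f` carries `P` into `Q`). -/
def mapQ' {R X Y : Type} [Ring R] [AddCommGroup X] [AddCommGroup Y] [Module R X]
    [Module R Y] (P : Submodule R X) (Q : Submodule R Y) (f : X →ₗ[R] Y) :
    (X ⧸ P) →ₗ[R] (Y ⧸ Q) :=
  if h : P ≤ Q.comap f then Submodule.mapQ P Q f h else 0

/-- The map between submodules induced by `f` (the canonical restriction whenever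
`f` carries `P` into `Q`). -/
def restrict' {R X Y : Type} [Ring R] [AddCommGroup X] [AddCommGroup Y] [Module R X]
    [Module R Y] (P : Submodule R X) (Q : Submodule R Y) (f : X →ₗ[R] Y) :
    P →ₗ[R] Q :=
  if h : ∀ x ∈ P, f x ∈ Q then f.restrict h else 0

/-- The subquotient `W / W'` of a module. -/
abbrev subQuot {R X : Type} [Ring R] [AddCommGroup X] [Module R X]
    (W W' : Submodule R X) : Type :=
  W ⧸ (W'.comap W.subtype)

/-- The radical of a topological module: the intersection of its maximal open
submodules. -/
def radical (R : Type) [Ring R] (X : Type) [AddCommGroup X] [Module R X]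
    [TopologicalSpace X] : Submodule R X :=
  sInf {W : Submodule R X | IsCoatom W ∧ IsOpen (W : Set X)}

/-- Iterated radicals `Rad^i(X)`, with `Rad^0(X) = X`. -/
def radPow (R : Type) [Ring R] (X : Type) [AddCommGroup X] [Module R X]
    [TopologicalSpace X] : ℕ → Submodule R X
  | 0 => ⊤
  | (n + 1) => (radical R (radPow R X n)).map (radPow R X n).subtype

/-- A topological module is semisimple if every closed submodule has a closed
complement. -/
def IsSemisimpleTop (R : Type) [Ring R] (X : Type) [AddCommGroup X] [Module R X]
    [TopologicalSpace X] : Prop :=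
  ∀ W : Submodule R X, IsClosed (W : Set X) →
    ∃ W' : Submodule R X, IsClosed (W' : Set X) ∧ IsCompl W W'

/-- The socle of a topological module: the largest closed semisimple submodule
(defined as the join of all closed semisimple submodules). -/
def socle (R : Type) [Ring R] (X : Type) [AddCommGroup X] [Module R X]
    [TopologicalSpace X] : Submodule R X :=
  sSup {W : Submodule R X | IsClosed (W : Set X) ∧ IsSemisimpleTop R W}

/-- A module is uniserial if its submodules form a chain. -/
def Uniserial (R : Type) [Ring R] (X : Type) [AddCommGroup X] [Module R X] : Prop :=
  ∀ W W' : Submodule R X, W ≤ W' ∨ W' ≤ W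

/-- A topological module is (topologically) indecomposable if it is non-zero and
admits no non-trivial decomposition into closed direct summands. -/
def IsIndecTop (R : Type) [Ring R] (X : Type) [AddCommGroup X] [Module R X]
    [TopologicalSpace X] : Prop :=
  Nontrivial X ∧ ∀ W W' : Submodule R X, IsClosed (W : Set X) → IsClosed (W' : Set X) →
    IsCompl W W' → W = ⊥ ∨ W' = ⊥

/-- The inverse limit of a compatible system of modules indexed by a preorder,
realized as the submodule of compatible families in the product. -/
def compatLim {ι : Type} [Preorder ι] {R : Type} [Ring R] (T : ι → Type)
    [∀ i, AddCommGroup (T i)] [∀ i, Module R (T i)]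
    (t : ∀ i j, i ≤ j → (T i →ₗ[R] T j)) : Submodule R (∀ i, T i) where
  carrier := {f | ∀ (i j : ι) (h : i ≤ j), t i j h (f i) = f j}
  add_mem' ha hb i j h := by simp only [Pi.add_apply, map_add]; rw [ha i j h, hb i j h]
  zero_mem' i j h := by simp
  smul_mem' c a ha i j h := by simp only [Pi.smul_apply, map_smul]; rw [ha i j h]

/-- `X` has exactly `n` composition factors (measured along the radical series). -/
def HasNFactors (R : Type) [Ring R] (X : Type) [AddCommGroup X] [Module R X]
    [TopologicalSpace X] (n : ℕ) : Prop :=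
  radPow R X n = ⊥ ∧ ∀ m < n, radPow R X m ≠ ⊥

/-- `X` has infinitely many composition factors. -/
def HasInfFactors (R : Type) [Ring R] (X : Type) [AddCommGroup X] [Module R X]
    [TopologicalSpace X] : Prop :=
  ∀ n : ℕ, radPow R X n ≠ ⊥



section Coinvariants

variable {k : Type} [Field k] {G : Type} [Group G] [TopologicalSpace G]

variable (k G) in
/-- The (closed) submodule `I_N U` of a topological `k⟦G⟧`-module `U`: the smallest
closed submodule containing all elements `n • u - u` for `n ∈ N`.  Its quotient is the
module of `N`-coinvariants. -/
def coinvKer (N : OpenNormalSubgroup G) (U : Type) [AddCommGroup U]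
    [Module (CGA k G) U] [TopologicalSpace U] : Submodule (CGA k G) U :=
  sInf {W : Submodule (CGA k G) U | IsClosed (W : Set U) ∧
    ∀ n ∈ N.toSubgroup, ∀ u : U, ofG k G n • u - u ∈ W}

variable (k G) in
/-- The module of `N`-coinvariants `U_N` of a topological `k⟦G⟧`-module `U`. -/
abbrev coinv (N : OpenNormalSubgroup G) (U : Type) [AddCommGroup U]
    [Module (CGA k G) U] [TopologicalSpace U] : Type :=
  U ⧸ coinvKer k G N U

variable (k G) in
/-- The canonical projection `φ_N : U → U_N`. -/
def phi (N : OpenNormalSubgroup G) (U : Type) [AddCommGroup U]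
    [Module (CGA k G) U] [TopologicalSpace U] : U →ₗ[CGA k G] coinv k G N U :=
  (coinvKer k G N U).mkQ

lemma coinvKer_mono {N M : OpenNormalSubgroup G} (h : N ≤ M) (U : Type) [AddCommGroup U]
    [Module (CGA k G) U] [TopologicalSpace U] : coinvKer k G N U ≤ coinvKer k G M U :=
  sInf_le_sInf (fun W hW => ⟨hW.1, fun n hn u => hW.2 n (h hn) u⟩)

variable (k G) in
/-- The canonical projection `φ_{MN} : U_N → U_M` for `N ≤ M`. -/
def phiT (N M : OpenNormalSubgroup G) (h : N ≤ M) (U : Type) [AddCommGroup U]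
    [Module (CGA k G) U] [TopologicalSpace U] :
    coinv k G N U →ₗ[CGA k G] coinv k G M U :=
  Submodule.mapQ _ _ LinearMap.id (fun _ hx => coinvKer_mono h U hx)

variable (k G) in
/-- `N` acts trivially on the `k⟦G⟧`-module `W`. -/
def NTrivial (N : OpenNormalSubgroup G) (W : Type) [AddCommGroup W]
    [Module (CGA k G) W] : Prop :=
  ∀ n ∈ N.toSubgroup, ∀ w : W, ofG k G n • w = w

end Coinvariants

section Pseudocompact

variable (k : Type) [Field k]

/-- A pseudocompact module over a topological `k`-algebra `A`: a Hausdorff topological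
module possessing a basis of neighbourhoods of `0` consisting of open submodules of
finite codimension which intersect in `0`, and which is the inverse limit of the
corresponding discrete quotients. -/
structure IsPseudocompactMod (A : Type) [Ring A] [Algebra k A] [TopologicalSpace A]
    (X : Type) [AddCommGroup X] [Module k X] [Module A X] [IsScalarTower k A X]
    [TopologicalSpace X] : Prop where
  t2 : T2Space X
  addGroup : IsTopologicalAddGroup X
  contSMul : ContinuousSMul A X
  basis : (nhds (0 : X)).HasBasis
    (fun V : Submodule A X => IsOpen (V : Set X) ∧
      FiniteDimensional k (X ⧸ V.restrictScalars k))
    (fun V => (V : Set X))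
  inf_bot : (⨅ (V : Submodule A X) (_ : IsOpen (V : Set X) ∧
      FiniteDimensional k (X ⧸ V.restrictScalars k)), V) = ⊥
  complete : ∀ c : ∀ V : {V : Submodule A X // IsOpen (V : Set X) ∧
      FiniteDimensional k (X ⧸ V.restrictScalars k)}, X ⧸ V.1,
    (∀ (V W : {V : Submodule A X // IsOpen (V : Set X) ∧
        FiniteDimensional k (X ⧸ V.restrictScalars k)}), V.1 ≤ W.1 →
      mapQ' V.1 W.1 LinearMap.id (c V) = c W) →
    ∃ x : X, ∀ V, c V = Submodule.Quotient.mk x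

end Pseudocompact

section Blocks

variable (R : Type) [Ring R]

/-- A block idempotent: a centrally primitive idempotent of `R`. -/
structure IsBlockIdem (e : R) : Prop where
  idem : IsIdempotentElem e
  ne_zero : e ≠ 0
  central : e ∈ Set.center R
  primitive : ∀ f g : R, f ∈ Set.center R → g ∈ Set.center R → IsIdempotentElem f →
    IsIdempotentElem g → f * g = 0 → g * f = 0 → e = f + g → f = 0 ∨ g = 0

/-- The block `B = Re` determined by a central idempotent `e`, as a left `R`-module. -/
def blockMod (e : R) (he : e ∈ Set.center R) : Submodule R R where
  carrier := {a : R | a * e = a}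
  add_mem' := by intro a b ha hb; simp only [Set.mem_setOf_eq, add_mul] at *; rw [ha, hb]
  zero_mem' := by simp
  smul_mem' := by
    intro c a ha
    simp only [Set.mem_setOf_eq, smul_eq_mul, mul_assoc] at *
    rw [ha]

/-- A module belongs to the block of the central idempotent `e` if `e` acts as the
identity on it. -/
def InBlock {X : Type} [AddCommGroup X] [Module R X] (e : R) : Prop :=
  ∀ x : X, e • x = x

end Blocks

section Defect

variable {k : Type} [Field k] {G : Type} [Group G] [TopologicalSpace G]

variable (k G) in
/-- The conjugation action of `G` on `k⟦G⟧`. -/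
def conjAct (g : G) (x : CGA k G) : CGA k G :=
  ofG k G g * x * ofG k G g⁻¹

variable (k G) in
/-- The `H`-fixed points of `k⟦G⟧` under conjugation. -/
def fixedBy (H : Subgroup G) : Set (CGA k G) :=
  {x : CGA k G | ∀ h ∈ H, conjAct k G h x = x}

variable (k G) in
/-- The relative trace map `Tr_H^G` on `k⟦G⟧` (a finite sum over coset
representatives when `H` is open). -/
def trMap (H : Subgroup G) (x : CGA k G) : CGA k G :=
  ∑ᶠ c : G ⧸ H, conjAct k G (Quotient.out c) x

variable (k G) in
/-- The image `Tr_H^G(k⟦G⟧^H)`. -/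
def trImage (H : Subgroup G) : Set (CGA k G) :=
  trMap k G H '' fixedBy k G H

variable (k G) in
/-- `D` satisfies the defect property for `e`:
`e ∈ ⋂_N Tr_{DN}^G (k⟦G⟧^{DN})`. -/
def DefectProp (e : CGA k G) (D : Subgroup G) : Prop :=
  ∀ N : OpenNormalSubgroup G, e ∈ trImage k G (D ⊔ N.toSubgroup)

variable (k G) in
/-- `D` is a defect group of the block of `e`: a closed subgroup, minimal subject to
the defect property. -/
structure IsDefectGroup (e : CGA k G) (D : Subgroup G) : Prop where
  closed : IsClosed (D : Set G)
  defect : DefectProp k G e D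
  minimal : ∀ D' : Subgroup G, IsClosed ((D' : Set G)) → D' ≤ D →
    DefectProp k G e D' → D' = D

end Defect

section FiniteDefect

variable (k : Type) [Field k] (Q : Type) [Group Q]

/-- Conjugation on a finite level group algebra `k[Q]`. -/
def conjActF (q : Q) (x : MonoidAlgebra k Q) : MonoidAlgebra k Q :=
  MonoidAlgebra.single q 1 * x * MonoidAlgebra.single q⁻¹ 1

/-- `H`-fixed points of `k[Q]` under conjugation. -/
def fixedByF (H : Subgroup Q) : Set (MonoidAlgebra k Q) :=
  {x | ∀ h ∈ H, conjActF k Q h x = x}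

/-- The relative trace map `Tr_H^Q` on `k[Q]`. -/
def trMapF (H : Subgroup Q) (x : MonoidAlgebra k Q) : MonoidAlgebra k Q :=
  ∑ᶠ c : Q ⧸ H, conjActF k Q (Quotient.out c) x

/-- The image `Tr_H^Q(k[Q]^H)`. -/
def trImageF (H : Subgroup Q) : Set (MonoidAlgebra k Q) :=
  trMapF k Q H '' fixedByF k Q H

/-- `Dq` is a defect group of the block of `e` in the group algebra `k[Q]`. -/
structure IsDefectGroupF (e : MonoidAlgebra k Q) (Dq : Subgroup Q) : Prop where
  defect : e ∈ trImageF k Q Dq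
  minimal : ∀ D' : Subgroup Q, D' ≤ Dq → e ∈ trImageF k Q D' → D' = Dq

end FiniteDefect

section CyclicDefect

variable {k : Type} [Field k] {G : Type} [Group G] [TopologicalSpace G]

variable (G) in
/-- A subgroup is procyclic if it possesses a dense cyclic (abstract) subgroup. -/
def IsProcyclic (D : Subgroup G) : Prop :=
  ∃ g : G, closure ((Subgroup.zpowers g : Subgroup G) : Set G) = (D : Set G)

variable (G) in
/-- `D` is isomorphic, as a topological group, to the `p`-adic integers `ℤ_p`. -/
def IsZpGroup (p : ℕ) [Fact p.Prime] (D : Subgroup G) : Prop :=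
  ∃ φ : D ≃ₜ Multiplicative ℤ_[p], ∀ x y : D, φ (x * y) = φ x * φ y

variable (G) in
/-- `D` is a cyclic pro-`p` group: either a finite cyclic `p`-group or `ℤ_p`. -/
def IsCyclicProP (p : ℕ) [Fact p.Prime] (D : Subgroup G) : Prop :=
  (Finite D ∧ IsPGroup p D ∧ IsCyclic D) ∨ IsZpGroup G p D

end CyclicDefect

section Simples

variable {k : Type} [Field k] {G : Type} [Group G] [TopologicalSpace G]

variable (k G) in
/-- The projection `k⟦G⟧ → k[G/N]`. -/
def projN (N : OpenNormalSubgroup G) (x : CGA k G) :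
    MonoidAlgebra k (G ⧸ N.toSubgroup) :=
  (x : ∀ N : OpenNormalSubgroup G, MonoidAlgebra k (G ⧸ N.toSubgroup)) N

variable (k G) in
/-- `N` acts trivially on every simple module of the block of `e`. -/
def TrivOnSimples (e : CGA k G) (N : OpenNormalSubgroup G) : Prop :=
  ∀ (S : Type) [AddCommGroup S] [Module (CGA k G) S],
    IsSimpleModule (CGA k G) S → InBlock (CGA k G) (X := S) e → NTrivial k G N S

variable (k G) in
/-- Membership of `N` in the standard cofinal system `𝒩` for the block `B` of `e`
with defect group `D`: the coinvariant algebra `B_N` is a block of `k[G/N]` with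
defect group `DN/N`, and `N` acts trivially on every simple `B`-module. -/
structure GoodN (e : CGA k G) (D : Subgroup G) (N : OpenNormalSubgroup G) : Prop where
  blockN : IsBlockIdem (MonoidAlgebra k (G ⧸ N.toSubgroup)) (projN k G N e)
  defectN : IsDefectGroupF k (G ⧸ N.toSubgroup) (projN k G N e)
    (D.map (QuotientGroup.mk' N.toSubgroup))
  triv : TrivOnSimples k G e N

/-- A cofinal set of open normal subgroups. -/
def IsCofinal {G : Type} [Group G] [TopologicalSpace G]
    (𝒩 : Set (OpenNormalSubgroup G)) : Prop :=
  ∀ M : OpenNormalSubgroup G, ∃ N ∈ 𝒩, N ≤ M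

variable (k G) in
/-- A pseudocompact module is pro-uniserial (w.r.t. the cofinal system `𝒩`) if all
its coinvariant quotients at members of `𝒩` are uniserial. -/
def ProUniserial (𝒩 : Set (OpenNormalSubgroup G)) (U : Type) [AddCommGroup U]
    [Module (CGA k G) U] [TopologicalSpace U] : Prop :=
  ∀ N ∈ 𝒩, Uniserial (CGA k G) (coinv k G N U)

variable (k G) in
/-- `S` is a composition factor of the pseudocompact module `U`: it is a composition
factor of some finite coinvariant quotient `U_N`. -/
def IsCompFactorOf (U : Type) [AddCommGroup U] [Module (CGA k G) U]
    [TopologicalSpace U] (S : Type) [AddCommGroup S] [Module (CGA k G) S] : Prop :=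
  ∃ (N : OpenNormalSubgroup G) (W W' : Submodule (CGA k G) (coinv k G N U)),
    W' ≤ W ∧ Nonempty (subQuot W W' ≃ₗ[CGA k G] S)

variable (k G) in
/-- `S` is a composition factor of the finite-dimensional module `X`. -/
def IsCompFactorFin (X : Type) [AddCommGroup X] [Module (CGA k G) X]
    (S : Type) [AddCommGroup S] [Module (CGA k G) S] : Prop :=
  ∃ W W' : Submodule (CGA k G) X, W' ≤ W ∧ Nonempty (subQuot W W' ≃ₗ[CGA k G] S)

end Simples

section Projective

variable {k : Type} [Field k] {G : Type} [Group G] [TopologicalSpace G]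

variable (k G) in
/-- A pseudocompact `k⟦G⟧`-module is (categorically) projective if every continuous
surjection onto it from a pseudocompact module splits. -/
def IsPCProjective (P : Type) [AddCommGroup P] [Module (CGA k G) P]
    [TopologicalSpace P] : Prop :=
  ∀ (W : Type) [AddCommGroup W] [Module k W] [Module (CGA k G) W]
    [IsScalarTower k (CGA k G) W] [TopologicalSpace W],
    IsPseudocompactMod k (CGA k G) W →
    ∀ f : W →ₗ[CGA k G] P, Continuous f → Function.Surjective f →
      ∃ s : P →ₗ[CGA k G] W, Continuous s ∧ f.comp s = LinearMap.id

variable (k G) in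
/-- `P` is a projective cover of the simple module `S` in the block of `e`:
a pseudocompact projective module of the block together with a surjection onto `S`
whose kernel is superfluous (contained in the radical). -/
structure IsProjCover (e : CGA k G) (P : Type) [AddCommGroup P] [Module k P]
    [Module (CGA k G) P] [IsScalarTower k (CGA k G) P] [TopologicalSpace P]
    (S : Type) [AddCommGroup S] [Module (CGA k G) S] : Prop where
  pseudocompact : IsPseudocompactMod k (CGA k G) P
  inBlock : InBlock (CGA k G) (X := P) e
  projective : IsPCProjective k G P
  cover : ∃ π : P →ₗ[CGA k G] S, Function.Surjective π ∧
    LinearMap.ker π ≤ radical (CGA k G) P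

end Projective




/-- The map between subquotients induced by `f`. -/
def subQuotMap {R X Y : Type} [Ring R] [AddCommGroup X] [AddCommGroup Y] [Module R X]
    [Module R Y] (W W' : Submodule R X) (V V' : Submodule R Y) (f : X →ₗ[R] Y) :
    subQuot W W' →ₗ[R] subQuot V V' :=
  mapQ' (W'.comap W.subtype) (V'.comap V.subtype) (restrict' W V f)

/-- The conditions of Proposition 3.8 on a pair of pro-uniserial submodules `X`, `Y`
of an indecomposable projective `P`: `X ∩ Y = Soc(P)`, `X + Y = Rad(P)`, and
`Rad(P)/Soc(P) ≅ X/Soc(P) ⊕ Y/Soc(P)` with no common composition factors. -/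
def ProUniserialPair (k : Type) [Field k] (G : Type) [Group G] [TopologicalSpace G]
    (𝒩 : Set (OpenNormalSubgroup G)) (P : Type) [AddCommGroup P]
    [Module (CGA k G) P] [TopologicalSpace P]
    (X Y : Submodule (CGA k G) P) : Prop :=
  ProUniserial k G 𝒩 X ∧ ProUniserial k G 𝒩 Y ∧
  X ⊓ Y = socle (CGA k G) P ∧
  X ⊔ Y = radical (CGA k G) P ∧
  Nonempty ((subQuot (radical (CGA k G) P) (socle (CGA k G) P)) ≃ₗ[CGA k G]
    (subQuot X (socle (CGA k G) P) × subQuot Y (socle (CGA k G) P))) ∧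
  ∀ (T : Type) [AddCommGroup T] [Module (CGA k G) T], IsSimpleModule (CGA k G) T →
    ¬ (IsCompFactorOf k G (subQuot X (socle (CGA k G) P)) T ∧
       IsCompFactorOf k G (subQuot Y (socle (CGA k G) P)) T)

/-- `S : ι → Type` is a complete set of pairwise non-isomorphic representatives of
the simple modules of the block of `e`. -/
def IsSimpleReps (k : Type) [Field k] (G : Type) [Group G] [TopologicalSpace G]
    (e : CGA k G) {ι : Type} (S : ι → Type) [∀ i, AddCommGroup (S i)]
    [∀ i, Module (CGA k G) (S i)] : Prop :=
  (∀ i, IsSimpleModule (CGA k G) (S i) ∧ InBlock (CGA k G) (X := S i) e) ∧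
  (∀ i j, i ≠ j → IsEmpty (S i ≃ₗ[CGA k G] S j)) ∧
  (∀ (T : Type) [AddCommGroup T] [Module (CGA k G) T],
    IsSimpleModule (CGA k G) T → InBlock (CGA k G) (X := T) e →
      ∃ i, Nonempty (T ≃ₗ[CGA k G] S i))

section Brauer

/-- The size of the `ρ`-orbit of `i` (the number of edges at the corresponding vertex
of the Brauer tree). -/
def orbSize {ι : Type} (ρ : Equiv.Perm ι) (i : ι) : ℕ :=
  Function.minimalPeriod ρ i

/-- Data describing the exceptional vertex of a Brauer tree: `none` if there is no
exceptional vertex, and otherwise a flag recording whether it is a `ρ`-vertex or a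
`σ`-vertex together with an edge adjacent to it. -/
abbrev ExcVertex (ι : Type) : Type := Option (Bool × ι)

/-- The edge `i` is adjacent to the exceptional vertex, its `ρ`-endpoint being
exceptional. -/
def AdjExcRho {ι : Type} (ρ : Equiv.Perm ι) (exc : ExcVertex ι) (i : ι) : Prop :=
  ∃ j : ι, exc = some (true, j) ∧ ρ.SameCycle j i

/-- The edge `i` is adjacent to the exceptional vertex, its `σ`-endpoint being
exceptional. -/
def AdjExcSigma {ι : Type} (σ : Equiv.Perm ι) (exc : ExcVertex ι) (i : ι) : Prop :=
  ∃ j : ι, exc = some (false, j) ∧ σ.SameCycle j i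

/-- The edge `i` is adjacent to the exceptional vertex. -/
def AdjExc {ι : Type} (ρ σ : Equiv.Perm ι) (exc : ExcVertex ι) (i : ι) : Prop :=
  AdjExcRho ρ exc i ∨ AdjExcSigma σ exc i

end Brauer


section PComplements

/-- If `P` is a cyclic Sylow `p`-subgroup whose automorphisms induced by its normalizer become
trivial modulo a proper subgroup, then the normalizer of `P` centralizes it. -/
lemma normalizer_le_centralizer_of_cyclic {X : Type*} [Group X] [Finite X] {p : ℕ}
    [Fact p.Prime] (P : Sylow p X) (hc : IsCyclic P) (K : Subgroup X)
    (hPK : ¬ (P : Subgroup X) ≤ K)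
    (hcomm : ∀ x ∈ Subgroup.normalizer (P : Set X), ∀ u ∈ P, x * u * x⁻¹ * u⁻¹ ∈ K) :
    Subgroup.normalizer (P : Set X) ≤ Subgroup.centralizer (P : Set X) := by
  have hp : p.Prime := Fact.out
  intro x hx
  obtain ⟨⟨g, hg⟩, hgen⟩ := hc.exists_generator
  have hgen' : ∀ u ∈ P, ∃ n : ℤ, g ^ n = u := by
    intro u hu
    obtain ⟨n, hn⟩ := hgen ⟨u, hu⟩
    exact ⟨n, by simpa [Subtype.ext_iff] using hn⟩
  have hgK : g ∉ K := fun h => hPK fun u hu => by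
    obtain ⟨n, rfl⟩ := hgen' u hu
    exact K.zpow_mem h n
  obtain ⟨m, hm⟩ := hgen' (x * g * x⁻¹) ((Subgroup.mem_normalizer_iff.1 hx g).1 hg)
  obtain ⟨n, hn⟩ := (IsPGroup.iff_orderOf.1 P.isPGroup') ⟨g, hg⟩
  rw [Subgroup.orderOf_mk] at hn
  have hmK : g ^ (m - 1) ∈ K := by
    have := hcomm x hx g hg
    rwa [← hm, ← zpow_sub_one] at this
  have hdvd : (p : ℤ) ∣ m - 1 := by
    by_contra hnd
    have hcop : IsCoprime (m - 1) ((p : ℤ) ^ n) :=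
      (((Nat.prime_iff_prime_int.1 hp).coprime_iff_not_dvd.2 hnd).symm).pow_right
    obtain ⟨a, b, hab⟩ := hcop
    apply hgK
    have h1 : g = (g ^ (m - 1)) ^ a := by
      rw [← zpow_mul]
      conv_lhs => rw [← zpow_one g, ← hab, zpow_add, mul_comm b, zpow_mul g (_ ^ n)]
      have : g ^ ((p : ℤ) ^ n) = 1 := by
        have := pow_orderOf_eq_one g
        rw [hn] at this
        exact_mod_cast this
      rw [this, one_zpow, mul_one, mul_comm]
    rw [h1]
    exact K.zpow_mem hmK a
  have hpow : ∀ j : ℕ, x ^ j * g * (x ^ j)⁻¹ = g ^ (m ^ j) := by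
    intro j
    induction j with
    | zero => simp
    | succ j ih =>
      have : x ^ (j + 1) * g * (x ^ (j + 1))⁻¹ = x * (x ^ j * g * (x ^ j)⁻¹) * x⁻¹ := by
        rw [pow_succ']; group
      rw [this, ih, ← conj_zpow, ← hm, ← zpow_mul, pow_succ']
  have hcent : ∀ y : X, Commute y g → y ∈ Subgroup.centralizer (P : Set X) := by
    intro y hy
    rw [Subgroup.mem_centralizer_iff]
    intro u hu
    obtain ⟨l, rfl⟩ := hgen' u hu
    exact (hy.zpow_right l).eq.symm
  have hx1 : x ^ (p ^ n) ∈ Subgroup.centralizer (P : Set X) := by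
    apply hcent
    have h2 : g ^ (m ^ p ^ n) = g := by
      have h3 : ((p : ℤ) ^ (n + 1)) ∣ m ^ p ^ n - 1 ^ p ^ n :=
        dvd_sub_pow_of_dvd_sub hdvd n
      rw [one_pow] at h3
      have h4 : (orderOf g : ℤ) ∣ m ^ p ^ n - 1 := by
        rw [hn]
        push_cast
        exact (pow_dvd_pow _ (Nat.le_succ n)).trans h3
      have h5 := orderOf_dvd_iff_zpow_eq_one.1 h4
      rw [zpow_sub_one, mul_inv_eq_one] at h5
      exact h5
    have := hpow (p ^ n)
    rw [h2] at this
    exact mul_inv_eq_iff_eq_mul.1 this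
  let N : Subgroup X := Subgroup.normalizer (P : Set X)
  let r := ((P : Subgroup X).subgroupOf N).index
  have hr : ¬ p ∣ r := fun h => P.not_dvd_index
    (h.trans (Subgroup.relIndex_dvd_index_of_le Subgroup.le_normalizer))
  have hx2 : x ^ r ∈ Subgroup.centralizer (P : Set X) := by
    apply hcent
    have : ((P : Subgroup X).subgroupOf N).Normal := Subgroup.normal_in_normalizer
    have := Subgroup.pow_index_mem ((P : Subgroup X).subgroupOf N) ⟨x, hx⟩
    rw [Subgroup.mem_subgroupOf] at this
    obtain ⟨l, hl⟩ := hgen' _ this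
    change g ^ l = x ^ r at hl
    rw [← hl]
    exact (Commute.refl g).zpow_left l
  have hcop : IsCoprime ((p : ℤ) ^ n) (r : ℤ) := by
    have := ((hp.coprime_iff_not_dvd.2 hr).pow_left n)
    exact_mod_cast Nat.isCoprime_iff_coprime.2 this
  obtain ⟨a, b, hab⟩ := hcop
  have : x = (x ^ p ^ n) ^ a * (x ^ r) ^ b := by
    rw [← zpow_natCast, ← zpow_natCast, ← zpow_mul, ← zpow_mul, ← zpow_add]
    push_cast
    rw [mul_comm _ a, mul_comm _ b, hab, zpow_one]
  rw [this]
  exact Subgroup.mul_mem _ (Subgroup.zpow_mem _ hx1 a) (Subgroup.zpow_mem _ hx2 b)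

/-- In the situation of Burnside's theorem the elements of order prime to `p` form a subgroup. -/
lemma exists_subgroup_coprime_order_of_normalizer_le {X : Type*} [Group X] [Finite X] {p : ℕ}
    [Fact p.Prime] (P : Sylow p X)
    (hP : Subgroup.normalizer (P : Set X) ≤ Subgroup.centralizer (P : Set X)) :
    ∃ L : Subgroup X, ∀ y, y ∈ L ↔ ¬ p ∣ orderOf y := by
  have hp : p.Prime := Fact.out
  let f := MonoidHom.transferSylow P hP
  refine ⟨f.ker, fun y => ⟨fun hy h => ?_, fun hy => ?_⟩⟩
  · apply MonoidHom.not_dvd_card_ker_transferSylow P hP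
    exact h.trans (Subgroup.orderOf_dvd_natCard _ hy)
  · rw [MonoidHom.mem_ker]
    obtain ⟨j, hj⟩ := IsPGroup.iff_orderOf.1 P.isPGroup' (f y)
    have h1 : orderOf (f y) ∣ orderOf y := orderOf_map_dvd f y
    rw [hj] at h1
    rw [← orderOf_eq_one_iff, hj]
    rcases Nat.eq_zero_or_pos j with rfl | h0
    · simp
    · exact absurd ((dvd_pow_self p h0.ne').trans h1) hy

/-- Let `K` be a normal subgroup and `P` a cyclic `p`-subgroup whose index in `KP` is prime
to `p`.  If `P` is trivial or not contained in `K`, then the elements of `K` of order prime to `p`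
form a subgroup. -/
lemma exists_subgroup_coprime_order {F : Type*} [Group F] [Finite F] {p : ℕ} [Fact p.Prime]
    (K P : Subgroup F) [K.Normal] (hPp : IsPGroup p P) (hc : IsCyclic P)
    (hidx : ¬ p ∣ P.relIndex (K ⊔ P)) (hPK : P = ⊥ ∨ ¬ P ≤ K) :
    ∃ L : Subgroup F, ∀ y, y ∈ L ↔ y ∈ K ∧ ¬ p ∣ orderOf y := by
  have hp : p.Prime := Fact.out
  rcases hPK with rfl | hPK
  · refine ⟨K, fun y => ⟨fun hy => ⟨hy, fun h => hidx ?_⟩, fun h => h.1⟩⟩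
    rw [sup_bot_eq, Subgroup.relIndex_bot_left]
    exact h.trans (Subgroup.orderOf_dvd_natCard _ hy)
  · let X := K ⊔ P
    have hPX : P ≤ X := le_sup_right
    have hKX : K ≤ X := le_sup_left
    have hPp' : IsPGroup p (P.subgroupOf X) :=
      hPp.of_equiv (Subgroup.subgroupOfEquivOfLe hPX).symm
    let S : Sylow p X := hPp'.toSylow hidx
    have hS : (S : Subgroup X) = P.subgroupOf X := rfl
    have hSc : IsCyclic S := by
      have e : P ≃* S := (Subgroup.subgroupOfEquivOfLe hPX).symm
      exact (e.isCyclic).1 hc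
    have hcm : ∀ x y : X, x * y * x⁻¹ * y⁻¹ ∈ K.subgroupOf X := by
      intro x y
      have hmap : ∀ x : X, QuotientGroup.mk' K (x : F) ∈ P.map (QuotientGroup.mk' K) := by
        intro x
        obtain ⟨a, ha, b, hb, hab⟩ := Subgroup.mem_sup_of_normal_left.1
          (show (x : F) ∈ K ⊔ P from x.2)
        refine ⟨b, hb, ?_⟩
        rw [← hab, map_mul]
        have : QuotientGroup.mk' K a = 1 := (QuotientGroup.eq_one_iff a).2 ha
        rw [this, one_mul]
      obtain ⟨a, ha, hxa⟩ := hmap x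
      obtain ⟨b, hb, hyb⟩ := hmap y
      rw [Subgroup.mem_subgroupOf, ← QuotientGroup.eq_one_iff]
      change QuotientGroup.mk' K _ = 1
      have hab : a * b = b * a := by
        let _ := hc.commGroup
        have := mul_comm (⟨a, ha⟩ : P) ⟨b, hb⟩
        simpa [Subtype.ext_iff] using this
      simp only [Subgroup.coe_mul, InvMemClass.coe_inv, map_mul, map_inv]
      rw [← hxa, ← hyb, ← map_mul, hab, map_mul]
      group
    have hSK : ¬ (S : Subgroup X) ≤ K.subgroupOf X := by
      intro h
      apply hPK
      intro u hu
      exact h (show (⟨u, hPX hu⟩ : X) ∈ P.subgroupOf X from hu)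
    obtain ⟨L, hL⟩ := exists_subgroup_coprime_order_of_normalizer_le S
      (normalizer_le_centralizer_of_cyclic S hSc _ hSK fun x _ u _ => hcm x u)
    refine ⟨L.map X.subtype ⊓ K, fun y => ?_⟩
    rw [Subgroup.mem_inf, and_comm]
    refine and_congr_right fun hy => ?_
    constructor
    · rintro ⟨z, hz, rfl⟩
      rw [Subgroup.subtype_apply, Subgroup.orderOf_coe]
      exact (hL z).1 hz
    · intro h
      refine ⟨⟨y, hKX hy⟩, (hL _).2 ?_, rfl⟩
      rwa [Subgroup.orderOf_mk]

end PComplements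

section FiniteGroupAlgebra

/-- A finite group acting through a `p`-group on a nonzero elementary abelian `p`-group has a
nonzero fixed point. -/
lemma exists_ne_zero_forall_smul_eq {p : ℕ} [Fact p.Prime] {K S : Type*} [Group K] [Finite K]
    [AddCommGroup S] [DistribMulAction K S] [Nontrivial S] (hS : ∀ s : S, p • s = 0)
    (hK : ∀ v : K, ∃ j : ℕ, ∀ s : S, v ^ p ^ j • s = s) :
    ∃ s : S, s ≠ 0 ∧ ∀ v : K, v • s = s := by
  obtain ⟨s, hs⟩ := exists_ne (0 : S)
  let _ : Module (ZMod p) S := by exact AddCommGroup.zmodModule hS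
  let A : Submodule (ZMod p) S := Submodule.span (ZMod p) (Set.range fun v : K => v • s)
  have hfin : Module.Finite (ZMod p) ↥A :=
    Module.Finite.span_of_finite (ZMod p) (Set.finite_range fun v : K => v • s)
  have hfinA : Finite A := Module.finite_of_finite (ZMod p)
  have hsA : s ∈ A := Submodule.subset_span ⟨1, one_smul _ _⟩
  have hstab : ∀ (v : K) (a : S), a ∈ A → v • a ∈ A := by
    intro v a ha
    let f : S →ₗ[ZMod p] S := (DistribSMul.toAddMonoidHom S v).toZModLinearMap p
    have : A ≤ A.comap f := by
      refine Submodule.span_le.2 ?_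
      rintro _ ⟨w, rfl⟩
      exact Submodule.subset_span ⟨v * w, mul_smul v w s⟩
    exact this ha
  let _ : MulAction K A :=
    { smul := fun v a => ⟨v • (a : S), hstab v a a.2⟩
      one_smul := fun a => Subtype.ext (one_smul K (a : S))
      mul_smul := fun v w a => Subtype.ext (mul_smul v w (a : S)) }
  have hsmul : ∀ (v : K) (a : A), ((v • a : A) : S) = v • (a : S) := fun _ _ => rfl
  have hR : IsPGroup p (MulAction.toPermHom K A).range := by
    rintro ⟨_, v, rfl⟩
    obtain ⟨j, hj⟩ := hK v
    refine ⟨j, Subtype.ext ?_⟩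
    rw [Subgroup.coe_pow, ← map_pow]
    ext a
    simpa [hsmul] using hj a
  have hcard : p ∣ Nat.card A := by
    have : Nontrivial A := ⟨⟨s, hsA⟩, 0, fun h => hs (congrArg Subtype.val h)⟩
    rw [Module.natCard_eq_pow_finrank (K := ZMod p), Nat.card_zmod]
    exact dvd_pow_self p (Module.finrank_pos).ne'
  have h0 : (0 : A) ∈ MulAction.fixedPoints (MulAction.toPermHom K A).range A := by
    rintro ⟨_, v, rfl⟩
    exact Subtype.ext (smul_zero v)
  obtain ⟨b, hb, hb0⟩ := hR.exists_fixed_point_of_prime_dvd_card_of_fixed_point A hcard h0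
  refine ⟨b, fun h => hb0 (Subtype.ext h.symm), fun v => ?_⟩
  exact congrArg Subtype.val (hb ⟨_, v, rfl⟩)

variable {k F : Type} [Field k] [Group F]

lemma single_mul_single_one (a b : F) :
    (MonoidAlgebra.single a 1 * MonoidAlgebra.single b 1 : MonoidAlgebra k F) =
      MonoidAlgebra.single (a * b) 1 := by
  simp [MonoidAlgebra.single_mul_single]

/-- An additive subgroup of a module over a group algebra that is stable under scalars and group
elements is stable under the group algebra. -/
lemma smul_mem_of_forall_single {S : Type*} [AddCommGroup S] [Module (MonoidAlgebra k F) S]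
    (W : AddSubgroup S)
    (hk : ∀ (r : k), ∀ s ∈ W, (algebraMap k (MonoidAlgebra k F) r) • s ∈ W)
    (hF : ∀ (g : F), ∀ s ∈ W, (MonoidAlgebra.single g 1 : MonoidAlgebra k F) • s ∈ W)
    (x : MonoidAlgebra k F) {s : S} (hs : s ∈ W) : x • s ∈ W := by
  induction x using MonoidAlgebra.induction_on generalizing s with
  | of g => exact hF g s hs
  | add x y hx hy => rw [add_smul]; exact W.add_mem (hx hs) (hy hs)
  | smul r x hx => rw [Algebra.smul_def, mul_smul]; exact hk r _ (hx hs)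

/-- If `K` is normal, `L` acts trivially on a simple module in characteristic `p`, and each element
of `K` has a `p`-power in `L`, then `K` acts trivially. -/
lemma single_smul_eq_of_isSimpleModule [Finite F] {p : ℕ} [Fact p.Prime] [CharP k p]
    (K L : Subgroup F) [K.Normal] (hKL : ∀ v ∈ K, ∃ j : ℕ, v ^ p ^ j ∈ L)
    {S : Type*} [AddCommGroup S] [Module (MonoidAlgebra k F) S]
    [hsimple : IsSimpleModule (MonoidAlgebra k F) S]
    (hL : ∀ y ∈ L, ∀ s : S, (MonoidAlgebra.single y 1 : MonoidAlgebra k F) • s = s)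
    {v : F} (hv : v ∈ K) (s : S) :
    (MonoidAlgebra.single v 1 : MonoidAlgebra k F) • s = s := by
  let W₀ : AddSubgroup S :=
    { carrier := {s | ∀ v ∈ K, (MonoidAlgebra.single v 1 : MonoidAlgebra k F) • s = s}
      zero_mem' := fun v _ => smul_zero _
      add_mem' := fun ha hb v hv => by rw [smul_add, ha v hv, hb v hv]
      neg_mem' := fun ha v hv => by rw [smul_neg, ha v hv] }
  let W : Submodule (MonoidAlgebra k F) S :=
    { W₀ with
      smul_mem' := fun x s hs => by
        refine smul_mem_of_forall_single W₀ (fun r s hs v hv => ?_) (fun g s hs v hv => ?_) x hs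
        · rw [smul_smul, ← Algebra.commutes, mul_smul, hs v hv]
        · have h1 := hs (g⁻¹ * v * g) (by
            simpa using (inferInstance : K.Normal).conj_mem v hv g⁻¹)
          calc _ = (MonoidAlgebra.single (v * g) 1 : MonoidAlgebra k F) • s := by
                rw [smul_smul, single_mul_single_one]
            _ = (MonoidAlgebra.single g 1 : MonoidAlgebra k F) •
                (MonoidAlgebra.single (g⁻¹ * v * g) 1 : MonoidAlgebra k F) • s := by
                rw [smul_smul, single_mul_single_one]; congr 2; group
            _ = _ := by rw [h1] }
  have hW : W = ⊤ := by
    refine (eq_bot_or_eq_top W).resolve_left fun h => ?_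
    have : Nontrivial S := IsSimpleModule.nontrivial (MonoidAlgebra k F) S
    let _ : DistribMulAction K S :=
      DistribMulAction.compHom S ((MonoidAlgebra.of k F).comp K.subtype)
    have hsm : ∀ (v : K) (s : S),
        v • s = (MonoidAlgebra.single (v : F) 1 : MonoidAlgebra k F) • s := fun _ _ => rfl
    obtain ⟨t, ht0, ht⟩ := exists_ne_zero_forall_smul_eq (p := p) (K := K) (S := S)
      (fun s => by
        rw [← Nat.cast_smul_eq_nsmul (MonoidAlgebra k F),
          ← map_natCast (algebraMap k (MonoidAlgebra k F)), CharP.cast_eq_zero, map_zero, zero_smul])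
      (fun v => by
        obtain ⟨j, hj⟩ := hKL v v.2
        exact ⟨j, fun s => by rw [hsm]; exact hL _ hj s⟩)
    have : t ∈ W := fun v hv => ht ⟨v, hv⟩
    rw [h] at this
    exact ht0 this
  have : s ∈ W := hW ▸ Submodule.mem_top
  exact this v hv

variable (k) in
/-- The average of the elements of a finite subgroup, in the group algebra. -/
def avg (L : Subgroup F) : MonoidAlgebra k F :=
  (Nat.card L : k)⁻¹ • ∑ᶠ y : L, MonoidAlgebra.single (y : F) 1

lemma single_mul_avg [Finite F] (L : Subgroup F) {y : F} (hy : y ∈ L) :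
    MonoidAlgebra.single y 1 * avg k L = avg k L := by
  let _ := Fintype.ofFinite L
  rw [avg, mul_smul_comm, finsum_eq_sum_of_fintype, Finset.mul_sum]
  congr 1
  simp_rw [single_mul_single_one]
  exact Fintype.sum_equiv (Equiv.mulLeft (⟨y, hy⟩ : L)) _ _ fun _ => rfl

lemma avg_mul_eq_self [Finite F] (L : Subgroup F) (hL : (Nat.card L : k) ≠ 0)
    {x : MonoidAlgebra k F} (hx : ∀ y ∈ L, MonoidAlgebra.single y 1 * x = x) :
    avg k L * x = x := by
  let _ := Fintype.ofFinite L
  rw [avg, smul_mul_assoc, finsum_eq_sum_of_fintype, Finset.sum_mul,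
    Finset.sum_congr rfl fun (y : L) _ => hx y y.2, Finset.sum_const, Finset.card_univ,
    ← Nat.card_eq_fintype_card, ← Nat.cast_smul_eq_nsmul k, smul_smul, inv_mul_cancel₀ hL, one_smul]

lemma isIdempotentElem_avg [Finite F] (L : Subgroup F) (hL : (Nat.card L : k) ≠ 0) :
    IsIdempotentElem (avg k L) :=
  avg_mul_eq_self L hL fun _ hy => single_mul_avg L hy

/-- An element commuting with all group elements is central in the group algebra. -/
lemma mem_center_of_forall_single {x : MonoidAlgebra k F}
    (hx : ∀ g : F, MonoidAlgebra.single g 1 * x = x * MonoidAlgebra.single g 1) :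
    x ∈ Set.center (MonoidAlgebra k F) := by
  rw [Semigroup.mem_center_iff]
  intro y
  induction y using MonoidAlgebra.induction_on with
  | of g => exact hx g
  | add a b ha hb => rw [add_mul, mul_add, ha, hb]
  | smul r a ha => rw [smul_mul_assoc, mul_smul_comm, ha]

lemma avg_mem_center [Finite F] (L : Subgroup F) [hL : L.Normal] :
    avg k L ∈ Set.center (MonoidAlgebra k F) := by
  refine mem_center_of_forall_single fun g => ?_
  let _ := Fintype.ofFinite L
  rw [avg, mul_smul_comm, smul_mul_assoc, finsum_eq_sum_of_fintype, Finset.mul_sum, Finset.sum_mul]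
  congr 1
  simp_rw [single_mul_single_one]
  refine Fintype.sum_equiv
    { toFun := fun y : L => ⟨g * y * g⁻¹, hL.conj_mem y y.2 g⟩
      invFun := fun y : L => ⟨g⁻¹ * y * g, by simpa using hL.conj_mem y y.2 g⁻¹⟩
      left_inv := fun y => by ext; simp [mul_assoc]
      right_inv := fun y => by ext; simp [mul_assoc] } _ _ fun y => ?_
  simp

lemma avg_mul_single [Finite F] (L : Subgroup F) [L.Normal] {y : F} (hy : y ∈ L) :
    avg k L * MonoidAlgebra.single y 1 = avg k L := by
  rw [← Semigroup.mem_center_iff.1 (avg_mem_center L) (MonoidAlgebra.single y 1),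
    single_mul_avg L hy]

/-- A surjective homomorphism of groups carries averages to averages. -/
lemma mapDomain_avg {F' : Type} [Group F'] [Finite F] [Finite F'] (f : F →* F')
    (L : Subgroup F) (L' : Subgroup F') (hLL : L.map f = L')
    (hL : (Nat.card L : k) ≠ 0) (hL' : (Nat.card L' : k) ≠ 0) [L'.Normal] :
    MonoidAlgebra.mapDomainAlgHom k k f (avg k L) = avg k L' := by
  have hs : ∀ y : F, MonoidAlgebra.mapDomainAlgHom k k f (MonoidAlgebra.single y 1) =
      MonoidAlgebra.single (f y) 1 := fun y => by simp
  have h1 : avg k L' * MonoidAlgebra.mapDomainAlgHom k k f (avg k L) =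
      MonoidAlgebra.mapDomainAlgHom k k f (avg k L) := by
    refine avg_mul_eq_self L' hL' fun y hy => ?_
    subst hLL
    obtain ⟨z, hz, rfl⟩ := hy
    rw [← hs, ← map_mul, single_mul_avg L hz]
  have h2 : avg k L' * MonoidAlgebra.mapDomainAlgHom k k f (avg k L) = avg k L' := by
    let _ := Fintype.ofFinite L
    rw [avg.eq_def k L, map_smul, finsum_eq_sum_of_fintype, map_sum, mul_smul_comm, Finset.mul_sum]
    have : ∀ y : L, avg k L' * MonoidAlgebra.mapDomainAlgHom k k f
        (MonoidAlgebra.single (y : F) 1) = avg k L' := fun y => by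
      rw [hs, avg_mul_single L' (hLL ▸ ⟨y, y.2, rfl⟩)]
    rw [Finset.sum_congr rfl fun y _ => this y, Finset.sum_const, Finset.card_univ,
      ← Nat.card_eq_fintype_card, ← Nat.cast_smul_eq_nsmul k, smul_smul, inv_mul_cancel₀ hL,
      one_smul]
  rw [← h1, h2]

/-- If `L` is normal of order prime to `p` and each element of the normal subgroup `K` has a
`p`-power in `L`, then the augmentation ideal of `K` times the average of `L` lies in the
Jacobson radical. -/
lemma avg_mul_single_sub_one_mem_jacobson [Finite F] {p : ℕ} [Fact p.Prime] [CharP k p]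
    (K L : Subgroup F) [K.Normal] [L.Normal] (hcard : (Nat.card L : k) ≠ 0)
    (hKL : ∀ v ∈ K, ∃ j : ℕ, v ^ p ^ j ∈ L) {v : F} (hv : v ∈ K) :
    avg k L * (MonoidAlgebra.single v 1 - 1) ∈ Ring.jacobson (MonoidAlgebra k F) := by
  rw [Ring.jacobson_eq_sInf_isMaximal, Submodule.mem_sInf]
  intro I hI
  have hc := Semigroup.mem_center_iff.1 (avg_mem_center (k := k) L)
  have hsimple : IsSimpleModule (MonoidAlgebra k F) (MonoidAlgebra k F ⧸ I) :=
    isSimpleModule_iff_quot_maximal.2 ⟨I, hI, ⟨LinearEquiv.refl _ _⟩⟩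
  let W : Submodule (MonoidAlgebra k F) (MonoidAlgebra k F ⧸ I) :=
    { carrier := {s | avg k L • s = s}
      zero_mem' := smul_zero _
      add_mem' := fun ha hb => by
        change _ • _ = _
        rw [smul_add, show avg k L • _ = _ from ha, show avg k L • _ = _ from hb]
      smul_mem' := fun x s hs => by
        change _ • _ = _
        rw [smul_smul, ← hc, mul_smul, show avg k L • s = s from hs] }
  have hidem : ∀ s : MonoidAlgebra k F ⧸ I, avg k L • s ∈ W := fun s => by
    change _ • _ = _
    rw [smul_smul, (isIdempotentElem_avg L hcard).eq]
  suffices h : (avg k L * (MonoidAlgebra.single v 1 - 1)) •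
      (Submodule.Quotient.mk 1 : MonoidAlgebra k F ⧸ I) = 0 by
    rwa [← Submodule.Quotient.mk_smul, Submodule.Quotient.mk_eq_zero, smul_eq_mul, mul_one] at h
  rcases eq_bot_or_eq_top W with hW | hW
  · rw [mul_smul]
    have := hidem ((MonoidAlgebra.single v 1 - 1 : MonoidAlgebra k F) •
      (Submodule.Quotient.mk 1 : MonoidAlgebra k F ⧸ I))
    rwa [hW, Submodule.mem_bot] at this
  · have hfix : ∀ s : MonoidAlgebra k F ⧸ I, avg k L • s = s := fun s =>
      show s ∈ W from hW ▸ Submodule.mem_top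
    rw [mul_smul, hfix, sub_smul, one_smul, sub_eq_zero]
    refine single_smul_eq_of_isSimpleModule K L hKL (fun y hy s => ?_) hv _
    rw [← hfix s, smul_smul, single_mul_avg L hy]

/-- The kernel of reduction modulo a subgroup of `K`, multiplied by the average of `L`,
lies in the Jacobson radical. -/
lemma avg_mul_mem_jacobson_of_map_eq_zero [Finite F] {p : ℕ} [Fact p.Prime] [CharP k p]
    (K L : Subgroup F) [K.Normal] [L.Normal] (hcard : (Nat.card L : k) ≠ 0)
    (hKL : ∀ v ∈ K, ∃ j : ℕ, v ^ p ^ j ∈ L) {F' : Type} [Group F'] (f : F →* F')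
    (hf : f.ker ≤ K) {x : MonoidAlgebra k F}
    (hx : MonoidAlgebra.mapDomainAlgHom k k f x = 0) :
    avg k L * x ∈ Ring.jacobson (MonoidAlgebra k F) := by
  let σ : F' → F := Function.invFun f
  let s : MonoidAlgebra k F → MonoidAlgebra k F := fun x =>
    MonoidAlgebra.mapDomain σ (MonoidAlgebra.mapDomainAlgHom k k f x)
  have hc := Semigroup.mem_center_iff.1 (avg_mem_center (k := k) L)
  have key : ∀ x, avg k L * (s x - x) ∈ Ring.jacobson (MonoidAlgebra k F) := by
    intro x
    induction x using MonoidAlgebra.induction_linear with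
    | zero => simp [s, MonoidAlgebra.mapDomain_zero]
    | add x y hx hy =>
      have : s (x + y) - (x + y) = (s x - x) + (s y - y) := by
        simp only [s, map_add, MonoidAlgebra.mapDomain_add]; abel
      rw [this, mul_add]
      exact Ideal.add_mem _ hx hy
    | single g r =>
      have h1 : s (MonoidAlgebra.single g r) - MonoidAlgebra.single g r =
          MonoidAlgebra.single g r * (MonoidAlgebra.single (g⁻¹ * σ (f g)) 1 - 1) := by
        simp [s, mul_sub, MonoidAlgebra.single_mul_single, MonoidAlgebra.mapDomain_single]
      rw [h1, ← mul_assoc, ← hc, mul_assoc]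
      refine Ideal.mul_mem_left _ _
        (avg_mul_single_sub_one_mem_jacobson K L hcard hKL (hf ?_))
      rw [MonoidHom.mem_ker, map_mul, map_inv, show f (σ (f g)) = f g from
        Function.invFun_eq ⟨g, rfl⟩, inv_mul_cancel]
  have h2 := key x
  have hsx : s x = 0 := by simp only [s, hx, MonoidAlgebra.mapDomain_zero]
  rw [hsx, zero_sub, mul_neg] at h2
  exact neg_mem_iff.1 h2

/-- Commuting idempotents with nilpotent difference coincide. -/
lemma eq_of_isNilpotent_sub {R : Type*} [Ring R] {a b : R} (ha : IsIdempotentElem a)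
    (hb : IsIdempotentElem b) (hab : a * b = b * a) (hn : IsNilpotent (a - b)) : a = b := by
  have ha' := ha.eq
  have hb' := hb.eq
  have h3 : (a - b) * ((a - b) * (a - b)) = a - b := by
    have h1 : (a - b) * (a - b) = a - a * b - a * b + b := by
      rw [mul_sub, sub_mul, sub_mul, ha', hb', ← hab]; abel
    have h4 : a * (a * b) = a * b := by rw [← mul_assoc, ha']
    have h5 : b * (a * b) = a * b := by rw [← mul_assoc, ← hab, mul_assoc, hb']
    rw [h1]
    simp only [mul_sub, sub_mul, mul_add, ha', hb', h4, h5, ← hab]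
    abel
  have hq : IsIdempotentElem ((a - b) * (a - b)) := by
    unfold IsIdempotentElem
    rw [mul_assoc, h3]
  have hq0 : (a - b) * (a - b) = 0 := by
    obtain ⟨n, hn⟩ := hn
    have : ((a - b) * (a - b)) ^ (n + 1) = 0 := by
      rw [← pow_two, ← pow_mul, pow_eq_zero_of_le (by omega) hn]
    rwa [hq.pow_succ_eq] at this
  rw [hq0, mul_zero] at h3
  exact sub_eq_zero.1 h3.symm

variable (k F) in
/-- A finite-dimensional algebra has only finitely many central idempotents. -/
lemma finite_central_idempotents [Finite F] :
    {f : MonoidAlgebra k F | f ∈ Set.center (MonoidAlgebra k F) ∧ IsIdempotentElem f}.Finite := by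
  let Z := Subalgebra.center k (MonoidAlgebra k F)
  have : IsArtinianRing Z := IsArtinianRing.of_finite k _
  have hfin : Finite {z : Z // IsIdempotentElem z} := by
    have : Finite (TopologicalSpace.Clopens (PrimeSpectrum Z)) :=
      Finite.of_injective (fun U => (U : Set (PrimeSpectrum Z))) SetLike.coe_injective
    exact Finite.of_equiv _ (PrimeSpectrum.isIdempotentElemEquivClopens (R := Z)).symm.toEquiv
  refine (Set.finite_range fun z : {z : Z // IsIdempotentElem z} =>
    ((z : Z) : MonoidAlgebra k F)).subset ?_
  rintro f ⟨hf, hi⟩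
  exact ⟨⟨⟨f, hf⟩, Subtype.ext hi⟩, rfl⟩

/-- The Jacobson radical of the group algebra of a finite group is nil. -/
lemma isNilpotent_of_mem_jacobson [Finite F] {x : MonoidAlgebra k F}
    (hx : x ∈ Ring.jacobson (MonoidAlgebra k F)) : IsNilpotent x := by
  have : IsArtinianRing (MonoidAlgebra k F) := IsArtinianRing.of_finite k _
  obtain ⟨n, hn⟩ := IsArtinianRing.isNilpotent_jacobson_bot (R := MonoidAlgebra k F)
  rw [Ideal.jacobson_bot] at hn
  refine ⟨n, ?_⟩
  have := Ideal.pow_mem_pow hx n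
  rwa [hn] at this

end FiniteGroupAlgebra

section CompletedGroupAlgebra

variable {k : Type} [Field k] {G : Type} [Group G] [TopologicalSpace G]

@[simp]
lemma tHom_single {N M : OpenNormalSubgroup G} (h : N ≤ M) (g : G) (r : k) :
    tHom k G N M h (MonoidAlgebra.single (g : G ⧸ N.toSubgroup) r) =
      MonoidAlgebra.single (g : G ⧸ M.toSubgroup) r := by
  simp only [tHom, MonoidAlgebra.mapDomainAlgHom_apply, MonoidAlgebra.mapDomain_single]
  rfl

lemma tHom_ext {A : Type*} [Semiring A] [Algebra k A] {N : OpenNormalSubgroup G}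
    {f f' : MonoidAlgebra k (G ⧸ N.toSubgroup) →ₐ[k] A}
    (h : ∀ g : G, f (MonoidAlgebra.single (g : G ⧸ N.toSubgroup) 1) =
      f' (MonoidAlgebra.single (g : G ⧸ N.toSubgroup) 1)) : f = f' := by
  refine MonoidAlgebra.algHom_ext (fun x => ?_) (Subsingleton.elim _ _)
  obtain ⟨g, rfl⟩ := QuotientGroup.mk_surjective x
  exact h g

lemma tHom_tHom {N M M' : OpenNormalSubgroup G} (h : N ≤ M) (h' : M ≤ M')
    (x : MonoidAlgebra k (G ⧸ N.toSubgroup)) :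
    tHom k G M M' h' (tHom k G N M h x) = tHom k G N M' (h.trans h') x :=
  DFunLike.congr_fun (tHom_ext (f := (tHom k G M M' h').comp (tHom k G N M h))
    (f' := tHom k G N M' (h.trans h')) fun g => by simp) x

@[simp]
lemma tHom_self {N : OpenNormalSubgroup G} (h : N ≤ N)
    (x : MonoidAlgebra k (G ⧸ N.toSubgroup)) : tHom k G N N h x = x :=
  DFunLike.congr_fun (tHom_ext (f := tHom k G N N h) (f' := AlgHom.id k _) fun g => by simp) x

variable (k) in
/-- The projection `k⟦G⟧ → k[G/N]` as an algebra homomorphism. -/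
def projHom (N : OpenNormalSubgroup G) :
    CGA k G →ₐ[k] MonoidAlgebra k (G ⧸ N.toSubgroup) :=
  (Pi.evalAlgHom k _ N).comp (CGA k G).val

@[simp]
lemma projHom_ofG (N : OpenNormalSubgroup G) (g : G) :
    projHom k N (ofG k G g) = MonoidAlgebra.single (g : G ⧸ N.toSubgroup) 1 := rfl

lemma tHom_projHom {N M : OpenNormalSubgroup G} (h : N ≤ M) (x : CGA k G) :
    tHom k G N M h (projHom k N x) = projHom k M x := x.2 N M h

/-- Elements of `k⟦G⟧` are determined by their images in `k[G/M]` for `M` small. -/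
lemma ext_of_projHom_eq (V : OpenNormalSubgroup G) {x y : CGA k G}
    (h : ∀ M ≤ V, projHom k M x = projHom k M y) : x = y := by
  refine Subtype.ext (funext fun M => ?_)
  change projHom k M x = projHom k M y
  rw [← tHom_projHom (inf_le_left : M ⊓ V ≤ M), h _ inf_le_right, tHom_projHom]

/-- A compatible family over the open normal subgroups contained in `V` comes from `k⟦G⟧`. -/
lemma exists_projHom_eq (V : OpenNormalSubgroup G)
    (c : ∀ M : OpenNormalSubgroup G, M ≤ V → MonoidAlgebra k (G ⧸ M.toSubgroup))
    (hc : ∀ (M M' : OpenNormalSubgroup G) (hM : M ≤ V) (hM' : M' ≤ V) (h : M ≤ M'),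
      tHom k G M M' h (c M hM) = c M' hM') :
    ∃ x : CGA k G, ∀ M (hM : M ≤ V), projHom k M x = c M hM := by
  refine ⟨⟨fun M => tHom k G (M ⊓ V) M inf_le_left (c (M ⊓ V) inf_le_right), ?_⟩, ?_⟩
  · intro M M' h
    have := hc (M ⊓ V) (M' ⊓ V) inf_le_right inf_le_right (inf_le_inf_right V h)
    dsimp only
    rw [← this, tHom_tHom, tHom_tHom]
  · intro M hM
    exact hc (M ⊓ V) M inf_le_right hM inf_le_left

lemma mem_center_of_projHom_mem_center (V : OpenNormalSubgroup G) {x : CGA k G}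
    (h : ∀ M ≤ V, projHom k M x ∈ Set.center (MonoidAlgebra k (G ⧸ M.toSubgroup))) :
    x ∈ Set.center (CGA k G) := by
  rw [Semigroup.mem_center_iff]
  intro y
  refine ext_of_projHom_eq V fun M hM => ?_
  rw [map_mul, map_mul, Semigroup.mem_center_iff.1 (h M hM)]

lemma projHom_mem_center {x : CGA k G} (hx : x ∈ Set.center (CGA k G))
    (M : OpenNormalSubgroup G) :
    projHom k M x ∈ Set.center (MonoidAlgebra k (G ⧸ M.toSubgroup)) := by
  refine mem_center_of_forall_single fun g => ?_
  obtain ⟨g, rfl⟩ := QuotientGroup.mk_surjective g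
  have := congrArg (projHom k M) (Semigroup.mem_center_iff.1 hx (ofG k G g))
  simpa using this

lemma tHom_mem_center {N M : OpenNormalSubgroup G} (h : N ≤ M)
    {x : MonoidAlgebra k (G ⧸ N.toSubgroup)}
    (hx : x ∈ Set.center (MonoidAlgebra k (G ⧸ N.toSubgroup))) :
    tHom k G N M h x ∈ Set.center (MonoidAlgebra k (G ⧸ M.toSubgroup)) := by
  refine mem_center_of_forall_single fun g => ?_
  obtain ⟨g, rfl⟩ := QuotientGroup.mk_surjective g
  have := congrArg (tHom k G N M h)
    (Semigroup.mem_center_iff.1 hx (MonoidAlgebra.single (g : G ⧸ N.toSubgroup) 1))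
  simpa using this

/-- An element of `k⟦G⟧` whose images in all small `k[G/M]` are units is left invertible. -/
lemma exists_mul_eq_one_of_isUnit_projHom (V : OpenNormalSubgroup G) {x : CGA k G}
    (h : ∀ M ≤ V, IsUnit (projHom k M x)) : ∃ z, z * x = 1 := by
  choose u hu using h
  obtain ⟨z, hz⟩ := exists_projHom_eq V (fun M hM => (↑(u M hM)⁻¹ : MonoidAlgebra k _)) (by
    intro M M' hM hM' hle
    refine left_inv_eq_right_inv (a := projHom k M' x) ?_ (by rw [← hu M' hM']; simp)
    rw [← tHom_projHom hle, ← map_mul, ← hu M hM]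
    simp)
  refine ⟨z, ext_of_projHom_eq V fun M hM => ?_⟩
  rw [map_mul, hz M hM, ← hu M hM, map_one]
  simp

lemma projHom_ne_zero_of_le {x : CGA k G} {N M : OpenNormalSubgroup G} (h : N ≤ M)
    (hx : projHom k M x ≠ 0) : projHom k N x ≠ 0 := fun h0 => hx (by
  rw [← tHom_projHom h, h0, map_zero])

lemma exists_projHom_ne_zero {x : CGA k G} (hx : x ≠ 0) :
    ∃ N : OpenNormalSubgroup G, projHom k N x ≠ 0 := by
  by_contra! h
  exact hx (Subtype.ext (funext h))

variable [IsTopologicalGroup G] [CompactSpace G]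

instance (N : OpenNormalSubgroup G) : Finite (G ⧸ N.toSubgroup) :=
  Subgroup.quotient_finite_of_isOpen _ N.isOpen'

/-- An element whose images in all small `k[G/M]` lie in the Jacobson radical lies in the
Jacobson radical of `k⟦G⟧`. -/
lemma mem_jacobson_of_projHom_mem_jacobson (V : OpenNormalSubgroup G) {x : CGA k G}
    (h : ∀ M ≤ V, projHom k M x ∈ Ring.jacobson (MonoidAlgebra k (G ⧸ M.toSubgroup))) :
    x ∈ Ring.jacobson (CGA k G) := by
  rw [← Ideal.jacobson_bot, Ideal.mem_jacobson_iff]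
  intro y
  obtain ⟨z, hz⟩ := exists_mul_eq_one_of_isUnit_projHom V (x := 1 + y * x) (fun M hM => by
    rw [map_add, map_one, map_mul]
    exact (isNilpotent_of_mem_jacobson (Ideal.mul_mem_left _ _ (h M hM))).isUnit_one_add)
  refine ⟨z, ?_⟩
  rw [Ideal.mem_bot, sub_eq_zero, ← hz, mul_add, mul_one, mul_assoc, add_comm]

/-- If the augmentation ideal of `V` in the block of `e` is contained in the radical at each small
level, then `V` acts trivially on the simple modules of the block. -/
lemma trivOnSimples_of_mul_single_sub_one_mem_jacobson {e : CGA k G} (V : OpenNormalSubgroup G)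
    (h : ∀ M ≤ V, ∀ v ∈ V, projHom k M e *
      (MonoidAlgebra.single ((v : G) : G ⧸ M.toSubgroup) 1 - 1) ∈
        Ring.jacobson (MonoidAlgebra k (G ⧸ M.toSubgroup))) :
    TrivOnSimples k G e V := by
  intro S _ _ hS he v hv s
  have hj : e * (ofG k G v - 1) ∈ Ring.jacobson (CGA k G) :=
    mem_jacobson_of_projHom_mem_jacobson V fun M hM => by
      simpa using h M hM v hv
  have := Module.mem_annihilator.1 (IsSemisimpleModule.jacobson_le_annihilator _ S hj) s
  rwa [mul_smul, he, sub_smul, one_smul, sub_eq_zero] at this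

/-- If each reduction map below `V` has kernel contained in the radical on the block of `e`, then
`e` maps to a block idempotent at each sufficiently small level. -/
lemma exists_forall_isBlockIdem {e : CGA k G} (he : IsBlockIdem (CGA k G) e)
    (V : OpenNormalSubgroup G) (hV : projHom k V e ≠ 0)
    (h : ∀ (M M' : OpenNormalSubgroup G) (hMM : M ≤ M'), M' ≤ V →
      ∀ x : MonoidAlgebra k (G ⧸ M.toSubgroup), tHom k G M M' hMM x = 0 →
        projHom k M e * x ∈ Ring.jacobson (MonoidAlgebra k (G ⧸ M.toSubgroup))) :
    ∃ N₀ ≤ V, ∀ N ≤ N₀,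
      IsBlockIdem (MonoidAlgebra k (G ⧸ N.toSubgroup)) (projHom k N e) := by
  let C : ∀ M : OpenNormalSubgroup G, Set (MonoidAlgebra k (G ⧸ M.toSubgroup)) := fun M =>
    {f | (f ∈ Set.center (MonoidAlgebra k (G ⧸ M.toSubgroup)) ∧ IsIdempotentElem f) ∧
      projHom k M e * f = f}
  have hfin : ∀ M, (C M).Finite := fun M =>
    (finite_central_idempotents k (G ⧸ M.toSubgroup)).subset fun f hf => hf.1
  have hmaps : ∀ (M M' : OpenNormalSubgroup G) (hMM : M ≤ M'),
      Set.MapsTo (tHom k G M M' hMM) (C M) (C M') := fun M M' hMM f hf =>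
    ⟨⟨tHom_mem_center hMM hf.1.1, hf.1.2.map _⟩, by
      rw [← tHom_projHom hMM, ← map_mul, hf.2]⟩
  have hinj : ∀ (M M' : OpenNormalSubgroup G) (hMM : M ≤ M'), M' ≤ V →
      Set.InjOn (tHom k G M M' hMM) (C M) := by
    intro M M' hMM hM' a ha b hb hab
    have hmem := h M M' hMM hM' (a - b) (by rw [map_sub, hab, sub_self])
    rw [mul_sub, ha.2, hb.2] at hmem
    exact eq_of_isNilpotent_sub ha.1.2 hb.1.2 (Semigroup.mem_center_iff.1 hb.1.1 a)
      (isNilpotent_of_mem_jacobson hmem)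
  obtain ⟨N₀, hN₀, hmin⟩ : ∃ N₀ ≤ V, ∀ M ≤ V, (C N₀).ncard ≤ (C M).ncard := by
    have hne : ((fun M => (C M).ncard) '' Set.Iic V).Nonempty := ⟨_, V, Set.mem_Iic.2 le_rfl, rfl⟩
    obtain ⟨N₀, hN₀, hN₀'⟩ := Nat.sInf_mem hne
    exact ⟨N₀, hN₀, fun M hM => hN₀'.trans_le (Nat.sInf_le ⟨M, hM, rfl⟩)⟩
  have hsurj : ∀ (M M' : OpenNormalSubgroup G) (hMM : M ≤ M'), M' ≤ N₀ →
      ∀ f ∈ C M', ∃ f' ∈ C M, tHom k G M M' hMM f' = f := by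
    intro M M' hMM hM' f hf
    have h1 : (C M').ncard ≤ (C N₀).ncard :=
      Set.ncard_le_ncard_of_injOn _ (hmaps M' N₀ hM') (hinj M' N₀ hM' hN₀) (hfin _)
    have h2 := hmin M (hMM.trans (hM'.trans hN₀))
    have h3 : tHom k G M M' hMM '' C M = C M' :=
      Set.eq_of_subset_of_ncard_le (hmaps M M' hMM).image_subset
        (by rw [(hinj M M' hMM (hM'.trans hN₀)).ncard_image]; exact h1.trans h2)
        (hfin _)
    rwa [← h3] at hf
  refine ⟨N₀, hN₀, fun N hN => ⟨he.idem.map _, projHom_ne_zero_of_le (hN.trans hN₀) hV,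
    projHom_mem_center he.central N, ?_⟩⟩
  intro f g hf hg hfi hgi hfg hgf hefg
  have hfC : f ∈ C N := ⟨⟨hf, hfi⟩, by rw [hefg, add_mul, hfi.eq, hgf, add_zero]⟩
  choose c hcC hc using fun M (hM : M ≤ N) => hsurj M N hM hN f hfC
  obtain ⟨F, hF⟩ := exists_projHom_eq N c (by
    intro M M' hM hM' hMM
    refine hinj M' N hM' (hN.trans hN₀) (hmaps M M' hMM (hcC M hM)) (hcC M' hM') ?_
    rw [tHom_tHom, hc, hc])
  have hFN : projHom k N F = f := by
    rw [hF N le_rfl, ← hc N le_rfl, tHom_self]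
  have hFcen : F ∈ Set.center (CGA k G) :=
    mem_center_of_projHom_mem_center N fun M hM => hF M hM ▸ (hcC M hM).1.1
  have hFi : IsIdempotentElem F := ext_of_projHom_eq N fun M hM => by
    rw [map_mul, hF M hM, (hcC M hM).1.2.eq]
  have heF : e * F = F := ext_of_projHom_eq N fun M hM => by
    rw [map_mul, hF M hM, (hcC M hM).2]
  have hFe : F * e = F := by rw [Semigroup.mem_center_iff.1 he.central, heF]
  have hgF : projHom k N (e - F) = g := by rw [map_sub, hFN, hefg, add_sub_cancel_left]
  rcases he.primitive F (e - F) hFcen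
    (by
      rw [Semigroup.mem_center_iff]
      intro y
      rw [mul_sub, sub_mul, Semigroup.mem_center_iff.1 he.central,
        Semigroup.mem_center_iff.1 hFcen])
    hFi
    (by
      unfold IsIdempotentElem
      rw [sub_mul, mul_sub, mul_sub, he.idem.eq, heF, hFe, hFi.eq, sub_self, sub_zero])
    (by rw [mul_sub, hFe, hFi.eq, sub_self]) (by rw [sub_mul, heF, hFi.eq, sub_self])
    (by rw [add_sub_cancel]) with h0 | h0
  · left; rw [← hFN, h0, map_zero]
  · right; rw [← hgF, h0, map_zero]

end CompletedGroupAlgebra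

section CoprimeElements

variable {F F' : Type} [Group F] [Group F'] {p : ℕ}

/-- Every element of a finite group has a `p`-power whose order is prime to `p`. -/
lemma exists_not_dvd_orderOf_pow [Finite F] [Fact p.Prime] (y : F) :
    ∃ j : ℕ, ¬ p ∣ orderOf (y ^ p ^ j) := by
  obtain ⟨j, r, hr, hy⟩ := Nat.exists_eq_pow_mul_and_not_dvd (orderOf_pos y).ne' p
    (Fact.out : p.Prime).ne_one
  exact ⟨j, fun h => hr (h.trans (orderOf_dvd_of_pow_eq_one (by
    rw [← pow_mul, ← hy, pow_orderOf_eq_one])))⟩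

/-- The subgroup of elements of order prime to `p` in a normal subgroup is normal. -/
lemma normal_of_mem_iff_not_dvd_orderOf {K L : Subgroup F} [hK : K.Normal]
    (hL : ∀ y, y ∈ L ↔ y ∈ K ∧ ¬ p ∣ orderOf y) : L.Normal := by
  refine ⟨fun y hy g => (hL _).2 ⟨hK.conj_mem y ((hL y).1 hy).1 g, ?_⟩⟩
  have h := orderOf_injective (MulAut.conj g).toMonoidHom (MulAut.conj g).injective y
  rw [show g * y * g⁻¹ = (MulAut.conj g).toMonoidHom y from rfl, h]
  exact ((hL y).1 hy).2

lemma not_dvd_card_of_mem_iff_not_dvd_orderOf [Finite F] [Fact p.Prime] {K L : Subgroup F}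
    (hL : ∀ y, y ∈ L ↔ y ∈ K ∧ ¬ p ∣ orderOf y) : ¬ p ∣ Nat.card L := by
  intro h
  obtain ⟨y, hy⟩ := exists_prime_orderOf_dvd_card' p h
  exact ((hL y).1 y.2).2 (by rw [Subgroup.orderOf_coe, hy])

/-- Elements of order prime to `p` lift along surjective homomorphisms. -/
lemma map_eq_of_mem_iff_not_dvd_orderOf [Finite F] [Fact p.Prime] (f : F →* F')
    {K L : Subgroup F} {K' L' : Subgroup F'}
    (hK : K.map f = K') (hL : ∀ y, y ∈ L ↔ y ∈ K ∧ ¬ p ∣ orderOf y)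
    (hL' : ∀ y, y ∈ L' ↔ y ∈ K' ∧ ¬ p ∣ orderOf y) : L.map f = L' := by
  have hp : p.Prime := Fact.out
  refine le_antisymm ?_ fun y hy => ?_
  · rintro _ ⟨y, hy, rfl⟩
    exact (hL' _).2 ⟨hK ▸ ⟨y, ((hL y).1 hy).1, rfl⟩,
      fun h => ((hL y).1 hy).2 (h.trans (orderOf_map_dvd f y))⟩
  · obtain ⟨hyK, hyp⟩ := (hL' y).1 hy
    rw [← hK] at hyK
    obtain ⟨x, hx, rfl⟩ := hyK
    obtain ⟨j, hj⟩ := exists_not_dvd_orderOf_pow (p := p) x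
    have hmem : f x ^ p ^ j ∈ L.map f :=
      ⟨x ^ p ^ j, (hL _).2 ⟨K.pow_mem hx _, hj⟩, map_pow f x _⟩
    have hcop : (orderOf (f x)).Coprime (p ^ j) :=
      ((hp.coprime_iff_not_dvd.2 hyp).pow_left j).symm
    obtain ⟨m, hm⟩ := exists_pow_eq_self_of_coprime hcop.symm
    rw [← hm]
    exact (L.map f).pow_mem hmem m

end CoprimeElements

section CyclicImages

variable {p : ℕ} [Fact p.Prime] {G : Type} [Group G] [TopologicalSpace G]

/-- The image of a cyclic pro-`p` group in a finite discrete quotient is a cyclic `p`-group. -/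
lemma isPGroup_and_isCyclic_map_mk {D : Subgroup G} (hD : IsCyclicProP G p D)
    (M : OpenNormalSubgroup G) :
    IsPGroup p (D.map (QuotientGroup.mk' M.toSubgroup)) ∧
      IsCyclic (D.map (QuotientGroup.mk' M.toSubgroup)) := by
  have hsurj := (QuotientGroup.mk' M.toSubgroup).subgroupMap_surjective D
  rcases hD with ⟨-, hp, hc⟩ | ⟨φ, hφ⟩
  · exact ⟨hp.of_surjective _ hsurj, isCyclic_of_surjective _ hsurj⟩
  · let φ' : Multiplicative ℤ_[p] ≃* D := (MulEquiv.mk' φ.toEquiv hφ).symm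
    let ψ : Multiplicative ℤ_[p] →* D.map (QuotientGroup.mk' M.toSubgroup) :=
      ((QuotientGroup.mk' M.toSubgroup).subgroupMap D).comp φ'.toMonoidHom
    have hψ : Function.Surjective ψ := hsurj.comp φ'.surjective
    have hker : IsOpen {z : ℤ_[p] | ψ (Multiplicative.ofAdd z) = 1} := by
      have : {z : ℤ_[p] | ψ (Multiplicative.ofAdd z) = 1} =
          (fun z : ℤ_[p] => ((φ.symm (Multiplicative.ofAdd z) : D) : G)) ⁻¹' (M : Set G) := by
        ext z
        rw [Set.mem_ofPred_eq, Set.mem_preimage, Subtype.ext_iff]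
        exact QuotientGroup.eq_one_iff _
      rw [this]
      exact M.isOpen'.preimage (continuous_subtype_val.comp
        (φ.symm.continuous.comp continuous_ofAdd))
    constructor
    · intro y
      obtain ⟨z, rfl⟩ := hψ y
      have ht : Filter.Tendsto (fun n : ℕ => (p : ℤ_[p]) ^ n * Multiplicative.toAdd z)
          Filter.atTop (nhds 0) := by
        have := (tendsto_pow_atTop_nhds_zero_of_norm_lt_one
          ((PadicInt.norm_lt_one_iff_dvd (p : ℤ_[p])).2 dvd_rfl)).mul_const (Multiplicative.toAdd z)
        rwa [zero_mul] at this
      obtain ⟨n, hn⟩ := (ht.eventually (hker.mem_nhds (by simp))).exists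
      refine ⟨n, ?_⟩
      rw [← map_pow]
      have : Multiplicative.ofAdd ((p : ℤ_[p]) ^ n * Multiplicative.toAdd z) = z ^ p ^ n := by
        rw [← Nat.cast_pow, ← nsmul_eq_mul, ofAdd_nsmul, ofAdd_toAdd]
      rw [← this]
      exact hn
    · refine ⟨ψ (Multiplicative.ofAdd 1), fun y => ?_⟩
      obtain ⟨z, rfl⟩ := hψ y
      have hopen : IsOpen ((fun w : ℤ_[p] => w - Multiplicative.toAdd z) ⁻¹'
          {z : ℤ_[p] | ψ (Multiplicative.ofAdd z) = 1}) :=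
        hker.preimage (continuous_id.sub continuous_const)
      obtain ⟨m, hm⟩ := PadicInt.denseRange_natCast.exists_mem_open hopen
        ⟨Multiplicative.toAdd z, by simp⟩
      refine ⟨m, ?_⟩
      have h1 : ψ (Multiplicative.ofAdd ((m : ℤ_[p]) - Multiplicative.toAdd z)) = 1 := hm
      rw [ofAdd_sub, map_div, ofAdd_toAdd, div_eq_one] at h1
      rw [← h1]
      simp only [zpow_natCast]
      rw [← map_pow, ← ofAdd_nsmul, nsmul_one]

end CyclicImages

section RelativeIndex

variable {k : Type} [Field k] {G : Type} [Group G] [TopologicalSpace G] [IsTopologicalGroup G]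
  [CompactSpace G] {p : ℕ} [CharP k p]

/-- A relative trace with nonzero image in `k[G/N]` comes from a subgroup `H` whose index in `HN`
is prime to `p`. -/
lemma not_dvd_relIndex_of_mem_trImage {e : CGA k G} {H : Subgroup G} (hH : IsOpen (H : Set G))
    (he : e ∈ trImage k G H) (N : OpenNormalSubgroup G) (hN : projHom k N e ≠ 0) :
    ¬ p ∣ H.relIndex (H ⊔ N.toSubgroup) := by
  intro hdvd
  obtain ⟨x, hx, rfl⟩ := he
  refine hN ?_
  let Φ : G → MonoidAlgebra k (G ⧸ N.toSubgroup) := fun g => projHom k N (conjAct k G g x)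
  have hmul : ∀ g h : G, conjAct k G (g * h) x = conjAct k G g (conjAct k G h x) := by
    intro g h
    simp only [conjAct, map_mul, mul_inv_rev, mul_assoc]
  have hΦ : ∀ g y, y ∈ H ⊔ N.toSubgroup → Φ (g * y) = Φ g := by
    intro g y hy
    obtain ⟨h, hh, n, hn, rfl⟩ := Subgroup.mem_sup_of_normal_right.1 hy
    have hn1 : projHom k N (ofG k G n) = 1 := by
      rw [projHom_ofG, (QuotientGroup.eq_one_iff n).2 hn]; rfl
    have hn2 : projHom k N (ofG k G n⁻¹) = 1 := by
      rw [projHom_ofG, (QuotientGroup.eq_one_iff n⁻¹).2 (inv_mem hn)]; rfl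
    have h1 : projHom k N (conjAct k G n x) = projHom k N x := by
      simp only [conjAct, map_mul, hn1, hn2, one_mul, mul_one]
    have h2 : projHom k N (conjAct k G (g * (h * n)) x) =
        projHom k N (conjAct k G (g * h) x) := by
      rw [← mul_assoc, hmul]
      simp only [conjAct, map_mul] at h1 ⊢
      rw [h1]
    change projHom k N _ = projHom k N _
    rw [h2, hmul, hx h hh]
  have : Finite (G ⧸ H) := Subgroup.quotient_finite_of_isOpen _ hH
  let _ := Fintype.ofFinite (G ⧸ H)
  let E := Subgroup.quotientEquivProdOfLE (le_sup_left : H ≤ H ⊔ N.toSubgroup)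
  have : Finite (G ⧸ (H ⊔ N.toSubgroup)) :=
    Subgroup.quotient_finite_of_isOpen _ (Subgroup.isOpen_mono le_sup_left hH)
  let _ := Fintype.ofFinite (G ⧸ (H ⊔ N.toSubgroup))
  have : Finite ((H ⊔ N.toSubgroup : Subgroup G) ⧸ H.subgroupOf (H ⊔ N.toSubgroup)) :=
    Finite.of_injective (fun c => E.symm ((1 : G), c)) fun a b hab => by
      simpa using E.symm.injective hab
  let _ := Fintype.ofFinite ((H ⊔ N.toSubgroup : Subgroup G) ⧸ H.subgroupOf (H ⊔ N.toSubgroup))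
  have hE : ∀ c : G ⧸ H, Φ (Quotient.out c) = Φ (Quotient.out (E c).1) := by
    intro c
    have h1 : (E c).1 = ((Quotient.out c : G) : G ⧸ (H ⊔ N.toSubgroup)) := by
      conv_lhs => rw [← Quotient.out_eq c]
      rfl
    have h2 : (Quotient.out (E c).1)⁻¹ * Quotient.out c ∈ H ⊔ N.toSubgroup := by
      rw [← QuotientGroup.eq, ← h1]
      exact Quotient.out_eq _
    rw [← hΦ (Quotient.out (E c).1) _ h2, mul_inv_cancel_left]
  have hcard : (Fintype.card ((H ⊔ N.toSubgroup : Subgroup G) ⧸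
      H.subgroupOf (H ⊔ N.toSubgroup)) : k) = 0 := by
    rw [CharP.cast_eq_zero_iff k p, ← Nat.card_eq_fintype_card]
    exact hdvd
  calc projHom k N (trMap k G H x) = ∑ c : G ⧸ H, Φ (Quotient.out c) := by
        rw [trMap, finsum_eq_sum_of_fintype, map_sum]
    _ = ∑ c : (G ⧸ (H ⊔ N.toSubgroup)) ×
          ((H ⊔ N.toSubgroup : Subgroup G) ⧸ H.subgroupOf (H ⊔ N.toSubgroup)),
          Φ (Quotient.out c.1) := Fintype.sum_equiv E _ _ hE
    _ = 0 := by
        rw [Fintype.sum_prod_type]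
        refine Finset.sum_eq_zero fun c _ => ?_
        dsimp only
        rw [Finset.sum_const, Finset.card_univ, ← Nat.cast_smul_eq_nsmul k, hcard, zero_smul]

end RelativeIndex

section Main

variable {k : Type} [Field k] {G : Type} [Group G] [TopologicalSpace G] [IsTopologicalGroup G]
  [CompactSpace G] {p : ℕ} [Fact p.Prime] [CharP k p]

/-- There is an open normal subgroup `V` on which the block does not vanish, such that in each
finite quotient the elements of `V` of order prime to `p` form a subgroup. -/
lemma exists_openNormalSubgroup_coprime_order [TotallyDisconnectedSpace G] [T2Space G]
    {e : CGA k G} (he : e ≠ 0)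
    {D : Subgroup G} (hD : DefectProp k G e D) (hcyc : IsCyclicProP G p D) :
    ∃ V : OpenNormalSubgroup G, projHom k V e ≠ 0 ∧ ∀ M : OpenNormalSubgroup G, M ≤ V →
      ∃ L : Subgroup (G ⧸ M.toSubgroup), ∀ y, y ∈ L ↔
        y ∈ V.toSubgroup.map (QuotientGroup.mk' M.toSubgroup) ∧ ¬ p ∣ orderOf y := by
  obtain ⟨N, hN⟩ := exists_projHom_ne_zero he
  obtain ⟨V, hVN, hV⟩ : ∃ V ≤ N, D = ⊥ ∨ ¬ D ≤ V.toSubgroup := by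
    rcases eq_or_ne D ⊥ with h | h
    · exact ⟨N, le_rfl, Or.inl h⟩
    · obtain ⟨d, hd, hd1⟩ := D.ne_bot_iff_exists_ne_one.1 h |>.elim fun d hd =>
        (⟨d, d.2, fun h => hd (Subtype.ext h)⟩ : ∃ d : G, d ∈ D ∧ d ≠ 1)
      obtain ⟨U, hU⟩ := ProfiniteGrp.exist_openNormalSubgroup_sub_open_nhds_of_one
        (isOpen_compl_singleton (x := d)) (Ne.symm hd1)
      exact ⟨N ⊓ U, inf_le_left, Or.inr fun hDV => hU (hDV hd).2 rfl⟩
  have hVe := projHom_ne_zero_of_le hVN hN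
  refine ⟨V, hVe, fun M hM => ?_⟩
  obtain ⟨hp, hc⟩ := isPGroup_and_isCyclic_map_mk hcyc M
  refine exists_subgroup_coprime_order _ _ hp hc ?_ ?_
  · have h1 := not_dvd_relIndex_of_mem_trImage (p := p)
      (Subgroup.isOpen_mono le_sup_right M.isOpen') (hD M) V hVe
    rw [← Subgroup.map_sup, Subgroup.relIndex_map_map, QuotientGroup.ker_mk']
    rwa [sup_comm V.toSubgroup, sup_right_comm]
  · refine hV.imp (fun h => by rw [h, Subgroup.map_bot]) fun h hle => h fun d hd => ?_
    obtain ⟨v, hv, hvd⟩ := hle (Subgroup.mem_map_of_mem _ hd)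
    have : v⁻¹ * d ∈ V.toSubgroup := hM (QuotientGroup.eq.1 hvd)
    simpa using mul_mem hv this

/-- If in each finite quotient the elements of `V` of order prime to `p` form a subgroup, then the
averages of these subgroups act as the identity on a block not vanishing on `V`. -/
lemma projHom_mul_avg_eq {e : CGA k G} (he : IsBlockIdem (CGA k G) e)
    {V : OpenNormalSubgroup G} (hV : projHom k V e ≠ 0)
    (L : ∀ M : OpenNormalSubgroup G, M ≤ V → Subgroup (G ⧸ M.toSubgroup))
    (hL : ∀ M hM y, y ∈ L M hM ↔
      y ∈ V.toSubgroup.map (QuotientGroup.mk' M.toSubgroup) ∧ ¬ p ∣ orderOf y)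
    (M : OpenNormalSubgroup G) (hM : M ≤ V) :
    projHom k M e * avg k (L M hM) = projHom k M e := by
  have hnormal : ∀ M hM, (L M hM).Normal := fun M hM =>
    normal_of_mem_iff_not_dvd_orderOf (hL M hM)
  have hcard : ∀ M hM, (Nat.card (L M hM) : k) ≠ 0 := fun M hM h =>
    not_dvd_card_of_mem_iff_not_dvd_orderOf (hL M hM) ((CharP.cast_eq_zero_iff k p _).1 h)
  obtain ⟨E, hE⟩ := exists_projHom_eq V (fun M hM => avg k (L M hM)) (by
    intro M M' hM hM' hMM
    have := hnormal M' hM'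
    refine mapDomain_avg _ _ _ (map_eq_of_mem_iff_not_dvd_orderOf _ ?_ (hL M hM) (hL M' hM'))
      (hcard M hM) (hcard M' hM')
    rw [Subgroup.map_map]
    rfl)
  have hEcen : E ∈ Set.center (CGA k G) := mem_center_of_projHom_mem_center V fun M hM => by
    have := hnormal M hM
    rw [hE M hM]
    exact avg_mem_center _
  have hEi : IsIdempotentElem E := ext_of_projHom_eq V fun M hM => by
    rw [map_mul, hE M hM, (isIdempotentElem_avg _ (hcard M hM)).eq]
  have hEV : projHom k V E = 1 := by
    have hbot : L V le_rfl = ⊥ := by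
      rw [eq_bot_iff]
      intro y hy
      obtain ⟨v, hv, rfl⟩ := ((hL V le_rfl y).1 hy).1
      exact (QuotientGroup.eq_one_iff v).2 hv
    have h1 := avg_mul_eq_self (k := k) (L V le_rfl) (hcard V le_rfl) (x := 1) fun y hy => by
      rw [hbot, Subgroup.mem_bot] at hy
      rw [hy, mul_one]
      rfl
    rw [hE V le_rfl, ← h1, mul_one]
  have hecen := Semigroup.mem_center_iff.1 he.central
  have hEcen' := Semigroup.mem_center_iff.1 hEcen
  have h1 : e * E * (e * E) = e * E := by
    rw [mul_assoc, ← hEcen' (e * E), ← mul_assoc, ← mul_assoc, he.idem.eq, mul_assoc, hEi.eq]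
  have h2 : e * (e * E) = e * E := by rw [← mul_assoc, he.idem.eq]
  have h3 : e * E * e = e * E := by rw [hecen, h2]
  have key := he.primitive (e * E) (e - e * E)
    (Set.mul_mem_center he.central hEcen)
    (by
      rw [Semigroup.mem_center_iff]
      intro y
      rw [mul_sub, sub_mul, hecen, Semigroup.mem_center_iff.1 (Set.mul_mem_center he.central hEcen)])
    h1
    (by
      unfold IsIdempotentElem
      rw [sub_mul, mul_sub, mul_sub, he.idem.eq, h1, h2, h3, sub_self, sub_zero])
    (by rw [mul_sub, h1, h3, sub_self]) (by rw [sub_mul, h1, h2, sub_self])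
    (by rw [add_sub_cancel])
  have heE : e * E = e := by
    rcases key with h | h
    · refine absurd ?_ hV
      rw [← mul_one (projHom k V e), ← hEV, ← map_mul, h, map_zero]
    · exact (sub_eq_zero.1 h).symm
  rw [← hE M hM, ← map_mul, heE]

end Main

/-- Lemma 3.4: for a block `B` of `k⟦G⟧` with cyclic defect group,
there is an open normal subgroup `N₀`, acting trivially on every simple `B`-module,
such that for every open normal `N ≤ N₀` the coinvariant algebra `B_N` is a single
block of `k[G/N]` (i.e. the image of `e` in `k[G/N]` is a block idempotent). -/
theorem coinv_is_block_eventually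
    (p : ℕ) [Fact p.Prime] (k : Type) [Field k] [CharP k p] [IsAlgClosed k]
    (G : Type) [Group G] [TopologicalSpace G] [IsTopologicalGroup G]
    [CompactSpace G] [TotallyDisconnectedSpace G] [T2Space G]
    (e : CGA k G) (he : IsBlockIdem (CGA k G) e)
    (D : Subgroup G) (hD : IsDefectGroup k G e D)
    (hcyc : IsCyclicProP G p D) :
    ∃ N₀ : OpenNormalSubgroup G, TrivOnSimples k G e N₀ ∧
      ∀ N : OpenNormalSubgroup G, N ≤ N₀ →
        IsBlockIdem (MonoidAlgebra k (G ⧸ N.toSubgroup)) (projN k G N e) := by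
  obtain ⟨V, hV, hL⟩ := exists_openNormalSubgroup_coprime_order he.ne_zero hD.defect hcyc
  choose L hL using hL
  have heL := projHom_mul_avg_eq he hV L hL
  have hnormal : ∀ M hM, (L M hM).Normal := fun M hM =>
    normal_of_mem_iff_not_dvd_orderOf (hL M hM)
  have hcard : ∀ M hM, (Nat.card (L M hM) : k) ≠ 0 := fun M hM h =>
    not_dvd_card_of_mem_iff_not_dvd_orderOf (hL M hM) ((CharP.cast_eq_zero_iff k p _).1 h)
  have hpow : ∀ (M : OpenNormalSubgroup G) (hM : M ≤ V), ∀ v ∈ V.toSubgroup.map (QuotientGroup.mk' M.toSubgroup),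
      ∃ j : ℕ, v ^ p ^ j ∈ L M hM := fun M hM v hv => by
    obtain ⟨j, hj⟩ := exists_not_dvd_orderOf_pow (p := p) v
    exact ⟨j, (hL M hM _).2 ⟨pow_mem hv _, hj⟩⟩
  obtain ⟨N₀, hN₀, hblock⟩ := exists_forall_isBlockIdem he V hV fun M M' hMM hM' x hx => by
    have hM := hMM.trans hM'
    have := hnormal M hM
    rw [← heL M hM, mul_assoc]
    refine Ideal.mul_mem_left _ _ (avg_mul_mem_jacobson_of_map_eq_zero _ (L M hM) (hcard M hM)
      (hpow M hM) _ ?_ hx)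
    intro y hy
    obtain ⟨g, rfl⟩ := QuotientGroup.mk_surjective y
    exact ⟨g, hM' ((QuotientGroup.eq_one_iff g).1 hy), rfl⟩
  have htriv : TrivOnSimples k G e V :=
    trivOnSimples_of_mul_single_sub_one_mem_jacobson V fun M hM v hv => by
      have := hnormal M hM
      rw [← heL M hM, mul_assoc]
      exact Ideal.mul_mem_left _ _ (avg_mul_single_sub_one_mem_jacobson _ (L M hM) (hcard M hM)
        (hpow M hM) (Subgroup.mem_map_of_mem _ hv))
  exact ⟨N₀, fun S _ _ hS hB n hn => htriv S hS hB n (hN₀ hn), hblock⟩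

end ProfiniteBlocks
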